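/- For m ≥ 1, let P_m = ⟨a_0, …, a_k⟩ be the m-th P-sequence and set X_m = {i ∈ ℕ : 1 ≤ i ≤ k, a_i = -1} and Y_m = {i ∈ ℕ : 1 ≤ i ≤ k, a_i = 1}. Then for every n ≥ 1: X_{2n+1} ⊂ X_{2n+2} and Y_{2n+1} ⊂ Y_{2n+2}, and the sets U = X_{2n+2} \ X_{2n+1} and V = Y_{2n+2} \ Y_{2n+1} are disjoint, have the same cardinality, and satisfy ∑_{i∈U} i^s = ∑_{i∈V} i^s for every integer s with 0 ≤ s ≤ 2n. -/

import Mathlib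

/-- One step of the recursive construction of P-sequences. -/
def Pnext (a : List ℤ) : List ℤ :=
  if a.getLast! = -a.head! then a ++ a.reverse
  else a.dropLast ++ [0] ++ (a.dropLast.reverse.map (fun x => -x))

/-- `Pseq (n-1)` is the `n`-th P-sequence `P_n` (so `Pseq 0 = P_1 = ⟨1,-1⟩`). -/
def Pseq : ℕ → List ℤ
  | 0 => [1, -1]
  | n + 1 => Pnext (Pseq n)

/-- For `m ≥ 1` and `P_m = ⟨a_0,…,a_k⟩`, `Xset m = {1 ≤ i ≤ k : a_i = -1}`. -/
def Xset (m : ℕ) : Finset ℕ :=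
  (Finset.Icc 1 ((Pseq (m - 1)).length - 1)).filter
    (fun i => (Pseq (m - 1)).getD i 0 = -1)

/-- For `m ≥ 1` and `P_m = ⟨a_0,…,a_k⟩`, `Yset m = {1 ≤ i ≤ k : a_i = 1}`. -/
def Yset (m : ℕ) : Finset ℕ :=
  (Finset.Icc 1 ((Pseq (m - 1)).length - 1)).filter
    (fun i => (Pseq (m - 1)).getD i 0 = 1)

/-- The weighted sum `∑ lᵢ f(i)` of the entries of a list. -/
def weightedSum (l : List ℤ) (f : ℕ → ℤ) : ℤ :=
  ∑ i ∈ Finset.range l.length, l.getD i 0 * f i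

/-- All (shifted) power moments of `l` of order less than `m` vanish. -/
def MomentsVanish (l : List ℤ) (m : ℕ) : Prop :=
  ∀ s < m, ∀ d : ℕ, weightedSum l (fun i => ((i : ℤ) + d) ^ s) = 0

lemma weightedSum_append (l₁ l₂ : List ℤ) (f : ℕ → ℤ) :
    weightedSum (l₁ ++ l₂) f = weightedSum l₁ f + weightedSum l₂ (fun i => f (l₁.length + i)) := by
  simp only [weightedSum, List.length_append, Finset.sum_range_add]
  congr 1
  · refine Finset.sum_congr rfl fun i hi => ?_
    rw [List.getD_append _ _ _ _ (Finset.mem_range.1 hi)]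
  · refine Finset.sum_congr rfl fun i _ => ?_
    rw [List.getD_append_right _ _ _ _ (by omega), Nat.add_sub_cancel_left]

lemma getD_map_neg (l : List ℤ) (i : ℕ) :
    (l.map (fun x => -x)).getD i 0 = -l.getD i 0 := by
  simpa using List.getD_map (d := (0 : ℤ)) (l := l) (n := i) (f := fun x : ℤ => -x)

lemma weightedSum_map_neg (l : List ℤ) (f : ℕ → ℤ) :
    weightedSum (l.map (fun x => -x)) f = -weightedSum l f := by
  simp only [weightedSum, List.length_map, getD_map_neg, neg_mul, Finset.sum_neg_distrib]

lemma weightedSum_singleton (c : ℤ) (f : ℕ → ℤ) : weightedSum [c] f = c * f 0 := by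
  simp [weightedSum]

lemma MomentsVanish.of_sub_shift {l l' : List ℤ} {m c : ℕ} (h : MomentsVanish l m)
    (hl : ∀ f, weightedSum l' f = weightedSum l f - weightedSum l (fun i => f (c + i))) :
    MomentsVanish l' (m + 1) := by
  intro s hs d
  have expand : ∀ i : ℕ, (((c + i : ℕ) : ℤ) + d) ^ s =
      ∑ j ∈ Finset.range s, (c : ℤ) ^ (s - j) * s.choose j * ((i : ℤ) + d) ^ j
        + ((i : ℤ) + d) ^ s := by
    intro i
    rw [show (((c + i : ℕ) : ℤ) + d) = ((i : ℤ) + d) + c by push_cast; ring, add_pow,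
      Finset.sum_range_succ]
    simp only [Nat.sub_self, pow_zero, Nat.choose_self, Nat.cast_one, mul_one]
    congr 1
    exact Finset.sum_congr rfl fun j _ => by ring
  have lower : ∑ i ∈ Finset.range l.length, l.getD i 0 *
      ∑ j ∈ Finset.range s, (c : ℤ) ^ (s - j) * s.choose j * ((i : ℤ) + d) ^ j = 0 := by
    simp only [Finset.mul_sum]
    rw [Finset.sum_comm]
    refine Finset.sum_eq_zero fun j hj => ?_
    have hj' := h j (by have := Finset.mem_range.1 hj; omega) d
    simp_rw [mul_left_comm (l.getD _ 0) ((c : ℤ) ^ (s - j) * s.choose j), ← Finset.mul_sum]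
    exact mul_eq_zero_of_right _ hj'
  rw [hl]
  simp only [expand]
  simp only [weightedSum, mul_add, Finset.sum_add_distrib, lower]
  ring

lemma Pnext_of_antisymm {t : List ℤ} (h : (1 :: t).reverse = (1 :: t).map (fun x => -x)) :
    Pnext (1 :: t) = (1 :: t) ++ (1 :: t).map (fun x => -x) := by
  have : (1 :: t).getLast! = -1 := by
    rw [List.getLast!_eq_getLast?_getD, ← List.head?_reverse, h]
    simp
  rw [Pnext, if_pos (by rw [this]; simp), h]

lemma Pnext_of_palindrome {b : List ℤ} (h : (1 :: (b ++ [1])).reverse = 1 :: (b ++ [1])) :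
    Pnext (1 :: (b ++ [1])) = 1 :: b ++ [0] ++ ((1 :: b).map (fun x => -x)).reverse := by
  have hlast : (1 :: (b ++ [1]) : List ℤ).getLast! = 1 := by
    rw [List.getLast!_eq_getLast?_getD, ← List.head?_reverse, h]
    simp
  have hdrop : (1 :: (b ++ [1]) : List ℤ).dropLast = 1 :: b := by
    rw [← List.cons_append, List.dropLast_concat]
  rw [Pnext, if_neg (by rw [hlast]; simp), hdrop, List.map_reverse]

lemma exists_eq_of_palindrome {x : ℤ} {t : List ℤ}
    (h : (1 :: x :: t).reverse = 1 :: x :: t) : ∃ b : List ℤ, 1 :: x :: t = 1 :: (b ++ [1]) := by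
  obtain ⟨b, c, hb⟩ := (List.eq_nil_or_concat (x :: t)).resolve_left (by simp)
  rw [List.concat_eq_append] at hb
  rw [hb] at h ⊢
  simp at h
  exact ⟨b, by simp [h.1]⟩

/-- The entries of `l` lie in `{-1, 0, 1}`, its first entry is `1`, its second entry exists, and
its moments of order less than `m` vanish. -/
structure IsVanishingSignList (l : List ℤ) (m : ℕ) : Prop where
  head : ∃ x t, l = 1 :: x :: t
  mem : ∀ x ∈ l, x = -1 ∨ x = 0 ∨ x = 1
  vanish : MomentsVanish l m

lemma IsVanishingSignList.next_of_antisymm {l : List ℤ} {m : ℕ} (h : IsVanishingSignList l m)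
    (hl : l.reverse = l.map (fun x => -x)) :
    IsVanishingSignList (Pnext l) (m + 1) ∧ (Pnext l).reverse = Pnext l ∧
      Pnext l = l ++ l.map (fun x => -x) := by
  obtain ⟨x, t, rfl⟩ := h.head
  rw [Pnext_of_antisymm hl]
  refine ⟨⟨⟨x, _, rfl⟩, ?_, h.vanish.of_sub_shift (c := (1 :: x :: t).length) fun f => ?_⟩,
    ?_, rfl⟩
  · intro y hy
    rw [List.mem_append, List.mem_map] at hy
    rcases hy with hy | ⟨z, hz, rfl⟩
    · exact h.mem y hy
    · have := h.mem z hz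
      omega
  · rw [weightedSum_append, weightedSum_map_neg, sub_eq_add_neg]
  · rw [← hl, List.reverse_append, List.reverse_reverse]

lemma IsVanishingSignList.next_of_palindrome {l : List ℤ} {m : ℕ} (h : IsVanishingSignList l m)
    (hl : l.reverse = l) :
    IsVanishingSignList (Pnext l) (m + 1) ∧
      (Pnext l).reverse = (Pnext l).map (fun x => -x) := by
  obtain ⟨x, t, rfl⟩ := h.head
  obtain ⟨b, hb⟩ := exists_eq_of_palindrome hl
  rw [hb] at h hl ⊢
  rw [Pnext_of_palindrome hl]
  refine ⟨⟨?_, ?_, h.vanish.of_sub_shift (c := (1 :: b).length) fun f => ?_⟩, ?_⟩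
  · cases b <;> simp
  · intro y hy
    simp only [List.mem_append, List.mem_reverse, List.mem_map, List.mem_singleton] at hy
    rcases hy with (hy | rfl) | ⟨z, hz, rfl⟩
    · exact h.mem y (by simp only [List.mem_cons, List.mem_append] at hy ⊢; tauto)
    · simp
    · have := h.mem z (by simp only [List.mem_cons, List.mem_append] at hz ⊢; tauto)
      omega
  · have hrev : 1 :: (b ++ [1]) = [1] ++ (1 :: b).reverse := by
      rw [← hl]; simp
    have head : weightedSum (1 :: (b ++ [1])) f =
        weightedSum (1 :: b) f + f (1 :: b).length := by
      rw [← List.cons_append, weightedSum_append, weightedSum_singleton]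
      simp
    rw [head, hrev, weightedSum_append, weightedSum_append, weightedSum_append,
      weightedSum_singleton, weightedSum_singleton, ← List.map_reverse, weightedSum_map_neg]
    simp only [List.length_append, List.length_singleton, add_assoc, add_zero]
    ring
  · simp only [List.reverse_append, List.map_append, List.map_reverse, List.reverse_reverse,
      List.map_map]
    simp

lemma Pseq_even (n : ℕ) : IsVanishingSignList (Pseq (2 * n)) (2 * n + 1) ∧
    (Pseq (2 * n)).reverse = (Pseq (2 * n)).map (fun x => -x) := by
  induction n with
  | zero =>
    refine ⟨⟨⟨-1, [], rfl⟩, by simp [Pseq], fun s hs d => ?_⟩, by simp [Pseq]⟩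
    obtain rfl : s = 0 := by omega
    simp [Pseq, weightedSum, Finset.sum_range_succ]
  | succ k ih =>
    obtain ⟨h, hpal, -⟩ := ih.1.next_of_antisymm ih.2
    exact h.next_of_palindrome hpal

lemma mem_filter_append_sdiff (l : List ℤ) (c : ℤ) (hl : l ≠ []) :
    (Finset.Icc 1 ((l ++ l.map (fun x => -x)).length - 1)).filter
        (fun i => (l ++ l.map (fun x => -x)).getD i 0 = c) \
      (Finset.Icc 1 (l.length - 1)).filter (fun i => l.getD i 0 = c) =
    ((Finset.range l.length).filter (fun i => l.getD i 0 = -c)).map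
      (addLeftEmbedding l.length) := by
  have hpos := List.length_pos_iff.2 hl
  ext i
  simp only [Finset.mem_sdiff, Finset.mem_filter, Finset.mem_Icc, Finset.mem_map,
    Finset.mem_range, addLeftEmbedding_apply, List.length_append, List.length_map]
  rcases lt_or_ge i l.length with hi | hi
  · rw [List.getD_append _ _ _ _ hi]
    constructor
    · rintro ⟨⟨h, h'⟩, h''⟩
      exact absurd ⟨⟨h.1, by omega⟩, h'⟩ h''
    · rintro ⟨j, -, hj⟩
      omega
  · obtain ⟨j, rfl⟩ := Nat.exists_eq_add_of_le hi
    rw [List.getD_append_right _ _ _ _ hi, Nat.add_sub_cancel_left, getD_map_neg]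
    constructor
    · rintro ⟨⟨h, h'⟩, -⟩
      exact ⟨j, ⟨by omega, by omega⟩, rfl⟩
    · rintro ⟨j', ⟨h, h'⟩, hj⟩
      obtain rfl : j' = j := by omega
      exact ⟨⟨by omega, by omega⟩, fun h => by omega⟩

lemma filter_subset_filter_append (l l' : List ℤ) (c : ℤ) :
    (Finset.Icc 1 (l.length - 1)).filter (fun i => l.getD i 0 = c) ⊆
      (Finset.Icc 1 ((l ++ l').length - 1)).filter (fun i => (l ++ l').getD i 0 = c) := by
  intro i
  simp only [Finset.mem_filter, Finset.mem_Icc, List.length_append]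
  rintro ⟨h, h'⟩
  exact ⟨by omega, by rw [List.getD_append _ _ _ _ (by omega), h']⟩

lemma weightedSum_eq_sum_filter_sub {l : List ℤ} (hl : ∀ x ∈ l, x = -1 ∨ x = 0 ∨ x = 1)
    (f : ℕ → ℤ) :
    weightedSum l f = ∑ i ∈ (Finset.range l.length).filter (fun i => l.getD i 0 = 1), f i -
      ∑ i ∈ (Finset.range l.length).filter (fun i => l.getD i 0 = -1), f i := by
  rw [Finset.sum_filter, Finset.sum_filter, ← Finset.sum_sub_distrib, weightedSum]
  refine Finset.sum_congr rfl fun i hi => ?_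
  have hmem : l.getD i 0 ∈ l := by
    rw [List.getD_eq_getElem _ _ (Finset.mem_range.1 hi)]
    exact List.getElem_mem _
  rcases hl _ hmem with h | h | h <;> rw [h] <;> simp

/-- for every `n ≥ 1`, `X_{2n+1} ⊂ X_{2n+2}` and
`Y_{2n+1} ⊂ Y_{2n+2}`, and `U = X_{2n+2} \ X_{2n+1}`, `V = Y_{2n+2} \ Y_{2n+1}`
are disjoint sets of equal cardinality with `∑_{i∈U} i^s = ∑_{i∈V} i^s` for every
`0 ≤ s ≤ 2n`. -/
theorem Pseq_diff_ProuhetTarryEscott (n : ℕ) (hn : 1 ≤ n) :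
    Xset (2 * n + 1) ⊂ Xset (2 * n + 2) ∧ Yset (2 * n + 1) ⊂ Yset (2 * n + 2) ∧
    Disjoint (Xset (2 * n + 2) \ Xset (2 * n + 1))
      (Yset (2 * n + 2) \ Yset (2 * n + 1)) ∧
    (Xset (2 * n + 2) \ Xset (2 * n + 1)).card =
      (Yset (2 * n + 2) \ Yset (2 * n + 1)).card ∧
    ∀ s : ℕ, s ≤ 2 * n →
      ∑ i ∈ Xset (2 * n + 2) \ Xset (2 * n + 1), i ^ s =
        ∑ i ∈ Yset (2 * n + 2) \ Yset (2 * n + 1), i ^ s := by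
  obtain ⟨h, hanti⟩ := Pseq_even n
  have hnext : Pseq (2 * n + 1) = _ := (h.next_of_antisymm hanti).2.2
  obtain ⟨x, t, ht⟩ := h.head
  have hne : Pseq (2 * n) ≠ [] := by simp [ht]
  have hU : Xset (2 * n + 2) \ Xset (2 * n + 1) =
      ((Finset.range (Pseq (2 * n)).length).filter (fun i => (Pseq (2 * n)).getD i 0 = 1)).map
        (addLeftEmbedding (Pseq (2 * n)).length) := by
    have := mem_filter_append_sdiff (Pseq (2 * n)) (-1) hne
    rwa [neg_neg, ← hnext] at this
  have hV : Yset (2 * n + 2) \ Yset (2 * n + 1) =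
      ((Finset.range (Pseq (2 * n)).length).filter (fun i => (Pseq (2 * n)).getD i 0 = -1)).map
        (addLeftEmbedding (Pseq (2 * n)).length) := by
    have := mem_filter_append_sdiff (Pseq (2 * n)) 1 hne
    rwa [← hnext] at this
  have hsum : ∀ s : ℕ, s ≤ 2 * n →
      ∑ i ∈ Xset (2 * n + 2) \ Xset (2 * n + 1), i ^ s =
        ∑ i ∈ Yset (2 * n + 2) \ Yset (2 * n + 1), i ^ s := by
    intro s hs
    have hs' := h.vanish s (by omega) (Pseq (2 * n)).length
    rw [weightedSum_eq_sum_filter_sub h.mem, sub_eq_zero] at hs'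
    rw [hU, hV, Finset.sum_map, Finset.sum_map]
    simp only [addLeftEmbedding_apply, add_comm (Pseq (2 * n)).length]
    exact_mod_cast hs'
  have hcard : (Xset (2 * n + 2) \ Xset (2 * n + 1)).card =
      (Yset (2 * n + 2) \ Yset (2 * n + 1)).card := by
    simpa using hsum 0 (Nat.zero_le _)
  have hUne : (Xset (2 * n + 2) \ Xset (2 * n + 1)).Nonempty := by
    rw [hU, Finset.map_nonempty]
    exact ⟨0, by simp [ht]⟩
  have hVne : (Yset (2 * n + 2) \ Yset (2 * n + 1)).Nonempty := by
    rw [← Finset.card_pos, ← hcard]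
    exact hUne.card_pos
  have hX : Xset (2 * n + 1) ⊆ Xset (2 * n + 2) := by
    have := filter_subset_filter_append (Pseq (2 * n)) ((Pseq (2 * n)).map (fun x => -x)) (-1)
    rwa [← hnext] at this
  have hY : Yset (2 * n + 1) ⊆ Yset (2 * n + 2) := by
    have := filter_subset_filter_append (Pseq (2 * n)) ((Pseq (2 * n)).map (fun x => -x)) 1
    rwa [← hnext] at this
  refine ⟨⟨hX, Finset.sdiff_nonempty.1 hUne⟩, ⟨hY, Finset.sdiff_nonempty.1 hVne⟩, ?_, hcard, hsum⟩
  rw [hU, hV, Finset.disjoint_map]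
  exact Finset.disjoint_filter.2 fun i _ h₁ h₂ => by omega
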